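/- Set z = y⁻¹x⁻¹ and N = {1, x, y, x⁻¹, y⁻¹, xy, y⁻¹x⁻¹}. Suppose u ∈ {x, y, z}, t ∈ ℤ, v ∈ N, and g = (u^t)^v belongs to dom(ψ^{∘3}). Then ψ^{∘3}(g) is a power of x, of y, or of z; that is, there exist u' ∈ {x, y, z} and s ∈ ℤ with ψ^{∘3}(g) = u'^s. -/

import Mathlib

/-- F is the free group on two generators x and y. -/
abbrev F : Type := FreeGroup Bool

def x : F := FreeGroup.of false
def y : F := FreeGroup.of true

/-- The homomorphism F → ℤ/2ℤ sending x ↦ 0 and y ↦ 1. -/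
def toZ2 : F →* Multiplicative (ZMod 2) :=
  FreeGroup.lift fun s => Multiplicative.ofAdd (if s then (1 : ZMod 2) else 0)

/-- H is the kernel: the elements whose total exponent sum in y is even. -/
def H : Subgroup F := toZ2.ker

/-- g ∈ dom(ψ^{∘k}): dom(ψ^{∘0}) = F and dom(ψ^{∘(k+1)}) = {g ∈ H : ψ(g) ∈ dom(ψ^{∘k})}. -/
def inDom (ψ : H →* F) : ℕ → F → Prop
  | 0, _ => True
  | k + 1, g => ∃ h : g ∈ H, inDom ψ k (ψ ⟨g, h⟩)

open scoped Classical in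
/-- The iterate ψ^{∘k}: ψ^{∘0} = id and ψ^{∘(k+1)}(g) = ψ^{∘k}(ψ(g))
(with junk value 1 outside the domain). -/
noncomputable def iterPsi (ψ : H →* F) : ℕ → F → F
  | 0, g => g
  | k + 1, g => if h : g ∈ H then iterPsi ψ k (ψ ⟨g, h⟩) else 1

/-- The element `a` lies in the domain of `ψ` and `ψ` sends it to `b`. -/
def MapsTo (ψ : H →* F) (a b : F) : Prop := ∃ h : a ∈ H, ψ ⟨a, h⟩ = b

namespace MapsTo

variable {ψ : H →* F} {a a' b b' : F}

lemma one : MapsTo ψ 1 1 := ⟨H.one_mem, map_one ψ⟩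

lemma mul (ha : MapsTo ψ a a') (hb : MapsTo ψ b b') : MapsTo ψ (a * b) (a' * b') := by
  obtain ⟨ha, rfl⟩ := ha
  obtain ⟨hb, rfl⟩ := hb
  exact ⟨H.mul_mem ha hb, map_mul ψ ⟨a, ha⟩ ⟨b, hb⟩⟩

lemma inv (ha : MapsTo ψ a a') : MapsTo ψ a⁻¹ a'⁻¹ := by
  obtain ⟨ha, rfl⟩ := ha
  exact ⟨H.inv_mem ha, map_inv ψ ⟨a, ha⟩⟩

lemma zpow (ha : MapsTo ψ a a') (n : ℤ) : MapsTo ψ (a ^ n) (a' ^ n) := by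
  obtain ⟨ha, rfl⟩ := ha
  exact ⟨H.zpow_mem ha n, map_zpow ψ ⟨a, ha⟩ n⟩

lemma congr (ha : MapsTo ψ a a') (h : a = b) (h' : a' = b') : MapsTo ψ b b' := h ▸ h' ▸ ha

end MapsTo

/-- If `g` is in the domain of the `k`-th iterate of `ψ`, then its image there is a power of
`x`, `y` or `y⁻¹x⁻¹`. -/
def IterIsPower (ψ : H →* F) (k : ℕ) (g : F) : Prop :=
  inDom ψ k g → ∃ u' ∈ ({x, y, y⁻¹ * x⁻¹} : Set F), ∃ s : ℤ, iterPsi ψ k g = u' ^ s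

/-- Every power of `u`, conjugated by `v`, satisfies `IterIsPower ψ k`. -/
def ConjIterIsPower (ψ : H →* F) (k : ℕ) (u v : F) : Prop :=
  ∀ t : ℤ, IterIsPower ψ k (v⁻¹ * u ^ t * v)

section

variable {ψ : H →* F} {k : ℕ} {g g' u u' v w : F}

lemma IterIsPower.of_mapsTo (hg : MapsTo ψ g g') (h : IterIsPower ψ k g') :
    IterIsPower ψ (k + 1) g := by
  obtain ⟨hg, rfl⟩ := hg
  rintro ⟨_, hd⟩
  simpa only [iterPsi, dif_pos hg] using h hd

lemma IterIsPower.of_notMem (hg : g ∉ H) : IterIsPower ψ (k + 1) g :=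
  fun ⟨h, _⟩ => absurd h hg

lemma conj_zpow_mul (m t : ℤ) : (u ^ m * v)⁻¹ * u ^ t * (u ^ m * v) = v⁻¹ * u ^ t * v := by
  group

lemma toZ2_x : toZ2 x = 1 := by simp [toZ2, x]

lemma toZ2_y : toZ2 y = Multiplicative.ofAdd 1 := by simp [toZ2, y]

lemma toZ2_z : toZ2 (y⁻¹ * x⁻¹) = Multiplicative.ofAdd 1 := by
  rw [map_mul, map_inv, map_inv, toZ2_x, toZ2_y]; decide

lemma even_of_conj_zpow_mem (hu : toZ2 u = Multiplicative.ofAdd 1) {t : ℤ}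
    (h : v⁻¹ * u ^ t * v ∈ H) : Even t := by
  have h' : toZ2 (v⁻¹ * u ^ t * v) = 1 := h
  rw [map_mul, map_mul, map_inv, mul_right_comm, inv_mul_cancel, one_mul, map_zpow, hu,
    ← ofAdd_zsmul, ofAdd_eq_one, zsmul_one] at h'
  exact ZMod.intCast_eq_zero_iff_even.1 h'

/-- One application of `ψ` to conjugates of powers of an element outside `H`. -/
lemma ConjIterIsPower.of_sq (hu : toZ2 u = Multiplicative.ofAdd 1) (hsq : MapsTo ψ (u ^ 2) u')
    (m : ℤ) (hv : MapsTo ψ (u ^ m * v) w) (h : ConjIterIsPower ψ k u' w) :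
    ConjIterIsPower ψ (k + 1) u v := by
  intro t
  by_cases hg : v⁻¹ * u ^ t * v ∈ H
  · obtain ⟨s, rfl⟩ := even_of_conj_zpow_mem hu hg
    refine .of_mapsTo (((hv.inv.mul (hsq.zpow s)).mul hv).congr ?_ rfl) (h s)
    group
  · exact .of_notMem hg

/-- Conjugates of powers of `x` by elements outside `H` are killed by `ψ`. -/
lemma ConjIterIsPower.x_of_odd (hc : MapsTo ψ (y⁻¹ * x * y) 1) (hv : MapsTo ψ (y⁻¹ * v) w) :
    ConjIterIsPower ψ (k + 1) x v := by
  intro t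
  have hone : IterIsPower ψ k 1 := by
    clear hv hc
    induction k with
    | zero => exact fun _ => ⟨x, by simp, 0, by simp [iterPsi]⟩
    | succ k ih => exact ih.of_mapsTo .one
  refine hone.of_mapsTo (((hv.inv.mul (hc.zpow t)).mul hv).congr ?_ (by group))
  have : (y⁻¹ * x * y) ^ t = y⁻¹ * x ^ t * y := by
    simpa using conj_zpow (a := y⁻¹) (b := x) (i := t)
  rw [this]
  group

lemma ConjIterIsPower.self_zpow (hx : MapsTo ψ x y) (hy : MapsTo ψ (y ^ 2) (y⁻¹ * x⁻¹))
    (hz : MapsTo ψ ((y⁻¹ * x⁻¹) ^ 2) x) (hu : u ∈ ({x, y, y⁻¹ * x⁻¹} : Set F)) (m : ℤ) :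
    ConjIterIsPower ψ k u (u ^ m) := by
  suffices h : ∀ u ∈ ({x, y, y⁻¹ * x⁻¹} : Set F), ConjIterIsPower ψ k u 1 by
    intro t
    have := h u hu t
    rwa [← conj_zpow_mul m, mul_one] at this
  clear hu
  induction k with
  | zero => exact fun u hu t => fun _ => ⟨u, hu, t, by simp [iterPsi]⟩
  | succ k ih =>
    rintro u (rfl | rfl | rfl)
    · intro t
      exact (ih y (by simp) t).of_mapsTo ((hx.zpow t).congr (by simp) (by simp))
    · exact .of_sq toZ2_y hy 0 (MapsTo.one.congr (by simp) rfl) (ih _ (by simp))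
    · exact .of_sq toZ2_z hz 0 (MapsTo.one.congr (by simp) rfl) (ih _ (by simp))

end

/-- With z = y⁻¹x⁻¹ and N = {1, x, y, x⁻¹, y⁻¹, xy, y⁻¹x⁻¹}: if u ∈ {x,y,z}, t ∈ ℤ,
v ∈ N and g = (u^t)^v ∈ dom(ψ^{∘3}), then ψ^{∘3}(g) is a power of x, y, or z. -/
theorem stmt6 (ψ : H →* F)
    (hψx : ∀ u : H, (u : F) = x → ψ u = y)
    (hψy2 : ∀ u : H, (u : F) = y ^ 2 → ψ u = y⁻¹ * x⁻¹)
    (hψc : ∀ u : H, (u : F) = y⁻¹ * x * y → ψ u = 1)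
    (u : F) (hu : u ∈ ({x, y, y⁻¹ * x⁻¹} : Set F)) (t : ℤ)
    (v : F) (hv : v ∈ ({1, x, y, x⁻¹, y⁻¹, x * y, y⁻¹ * x⁻¹} : Set F))
    (hdom : inDom ψ 3 (v⁻¹ * u ^ t * v)) :
    ∃ u' ∈ ({x, y, y⁻¹ * x⁻¹} : Set F), ∃ s : ℤ,
      iterPsi ψ 3 (v⁻¹ * u ^ t * v) = u' ^ s := by
  have h₁ : MapsTo ψ x y := ⟨toZ2_x, hψx _ rfl⟩
  have h₂ : MapsTo ψ (y ^ 2) (y⁻¹ * x⁻¹) :=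
    ⟨show toZ2 _ = 1 by rw [map_pow, toZ2_y]; decide, hψy2 _ rfl⟩
  have h₃ : MapsTo ψ (y⁻¹ * x * y) 1 :=
    ⟨show toZ2 _ = 1 by rw [map_mul, map_mul, toZ2_x, map_inv, mul_one, inv_mul_cancel],
      hψc _ rfl⟩
  have h₄ : MapsTo ψ ((y⁻¹ * x⁻¹) ^ 2) x :=
    ((h₃.inv.mul h₂.inv).mul h₁.inv).congr (by rw [pow_two (y⁻¹ * x⁻¹)]; group) (by group)
  have self {k : ℕ} {u : F} (hu : u ∈ ({x, y, y⁻¹ * x⁻¹} : Set F)) (m : ℤ) {v : F}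
      (hv : u ^ m = v) : ConjIterIsPower ψ k u v := hv ▸ .self_zpow h₁ h₂ h₄ hu m
  have x_y {k : ℕ} : ConjIterIsPower ψ (k + 1) x y :=
    .x_of_odd h₃ (MapsTo.one.congr (by group) rfl)
  have x_y' {k : ℕ} : ConjIterIsPower ψ (k + 1) x y⁻¹ :=
    .x_of_odd h₃ (h₂.inv.congr (by group) rfl)
  have z_y {k : ℕ} : ConjIterIsPower ψ (k + 1) (y⁻¹ * x⁻¹) y :=
    .of_sq toZ2_z h₄ (-1) ((h₁.mul h₂).congr (by rw [zpow_neg_one, pow_two]; group) rfl)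
      (self (by simp) (-1) (by group))
  have z_y' {k : ℕ} : ConjIterIsPower ψ (k + 2) (y⁻¹ * x⁻¹) y⁻¹ :=
    .of_sq toZ2_z h₄ (-1) (h₁.congr (by group) rfl) x_y
  suffices h : ConjIterIsPower ψ 3 u v from h t hdom
  rcases hu with rfl | rfl | rfl
  · rcases hv with rfl | rfl | rfl | rfl | rfl | rfl | rfl
    · exact self (by simp) 0 (by group)
    · exact self (by simp) 1 (by group)
    · exact x_y
    · exact self (by simp) (-1) (by group)
    · exact x_y'
    · exact .x_of_odd h₃ (h₃.congr (by group) rfl)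
    · exact .x_of_odd h₃ ((h₂.inv.mul h₁.inv).congr (by group) rfl)
  · rcases hv with rfl | rfl | rfl | rfl | rfl | rfl | rfl
    · exact self (by simp) 0 (by group)
    · exact .of_sq toZ2_y h₂ 0 (h₁.congr (by group) rfl) z_y
    · exact self (by simp) 1 (by group)
    · exact .of_sq toZ2_y h₂ 0 (h₁.inv.congr (by group) rfl) z_y'
    · exact self (by simp) (-1) (by group)
    · exact .of_sq toZ2_y h₂ (-1) (h₃.congr (by group) rfl) (self (by simp) 0 (by group))
    · exact .of_sq toZ2_y h₂ 1 (h₁.inv.congr (by group) rfl) z_y'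
  · rcases hv with rfl | rfl | rfl | rfl | rfl | rfl | rfl
    · exact self (by simp) 0 (by group)
    · exact .of_sq toZ2_z h₄ 0 (h₁.congr (by group) rfl) x_y
    · exact z_y
    · exact .of_sq toZ2_z h₄ 0 (h₁.inv.congr (by group) rfl) x_y'
    · exact z_y'
    · exact self (by simp) (-1) (by group)
    · exact self (by simp) 1 (by group)
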